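/- Let δ : ℕ → ℕ₀ be a monotonically increasing function and let p be a fixed-height binary tree source such that for all i, j ∈ ℕ₀ with p(i,j) > 0 and max(i,j) = k−1 one has |i − j| ≤ δ(k). Then for every n ≥ 1, every natural number b ≥ 1, and every binary tree t with n nodes and P[t] > 0, one has n_{≥b}(t) ≤ 4·ln(2)·(2 + δ(n))·n·(log₂ b + 2)/b + 2n/b. -/

import Mathlib

inductive BinTree : Type where
  | leaf : BinTree
  | node : BinTree → BinTree → BinTree
deriving DecidableEq

namespace BinTree

def size : BinTree → ℕ
  | leaf => 0
  | node l r => 1 + size l + size r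

def height : BinTree → ℕ
  | leaf => 0
  | node l r => 1 + max (height l) (height r)

def subtreeAt : BinTree → List Bool → BinTree
  | t, [] => t
  | leaf, _ :: _ => leaf
  | node l r, b :: v => subtreeAt (if b then r else l) v

def countGE (b : ℕ) : BinTree → ℕ
  | leaf => 0
  | node l r => (if b ≤ size (node l r) then 1 else 0) + countGE b l + countGE b r

end BinTree

noncomputable def fsProb (p : ℕ → ℕ → ℝ) : BinTree → ℝ
  | .leaf => 1
  | .node l r => p l.size r.size * fsProb p l * fsProb p r

noncomputable def fhProb (p : ℕ → ℕ → ℝ) : BinTree → ℝ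
  | .leaf => 1
  | .node l r => p l.height r.height * fhProb p l * fhProb p r

def IsFixedSizeSource (p : ℕ → ℕ → ℝ) : Prop :=
  (∀ ℓ r, 0 ≤ p ℓ r ∧ p ℓ r ≤ 1) ∧
  ∀ n : ℕ, ∑ ℓ ∈ Finset.range (n + 1), p ℓ (n - ℓ) = 1

def IsFixedHeightSource (p : ℕ → ℕ → ℝ) : Prop :=
  (∀ i j, 0 ≤ p i j ∧ p i j ≤ 1) ∧
  ∀ h : ℕ,
    ∑ ij ∈ (Finset.range (h + 1) ×ˢ Finset.range (h + 1)).filter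
        (fun ij => max ij.1 ij.2 = h), p ij.1 ij.2 = 1

def BinTree.Bal (d : ℕ) : BinTree → Prop
  | .leaf => True
  | .node l r => (l.height ≤ r.height + d ∧ r.height ≤ l.height + d) ∧ Bal d l ∧ Bal d r

theorem BinTree.height_le_size (t : BinTree) : t.height ≤ t.size := by
  induction t with
  | leaf => simp [height, size]
  | node l r hl hr => simp only [height, size]; omega

theorem fhProb_nonneg {p : ℕ → ℕ → ℝ} (hp : ∀ i j, 0 ≤ p i j) (t : BinTree) : 0 ≤ fhProb p t := by
  induction t with
  | leaf => simp [fhProb]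
  | node l r hl hr =>
    simp only [fhProb]
    exact mul_nonneg (mul_nonneg (hp _ _) hl) hr

theorem bal_of_pos {δ : ℕ → ℕ} (hδ : Monotone δ) {p : ℕ → ℕ → ℝ} (hp : ∀ i j, 0 ≤ p i j)
    (hbal : ∀ k i j : ℕ, 0 < p i j → max i j + 1 = k → max i j - min i j ≤ δ k) (n : ℕ)
    (t : BinTree) (ht : t.size ≤ n) (hpos : 0 < fhProb p t) : t.Bal (δ n) := by
  induction t with
  | leaf => trivial
  | node l r hl hr =>
    simp only [fhProb] at hpos
    have h1 := hp l.height r.height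
    have h2 := fhProb_nonneg hp l
    have h3 := fhProb_nonneg hp r
    have h1' : 0 < p l.height r.height :=
      lt_of_le_of_ne h1 (fun h => by rw [← h] at hpos; simp at hpos)
    have h2' : 0 < fhProb p l := lt_of_le_of_ne h2 (fun h => by rw [← h] at hpos; simp at hpos)
    have h3' : 0 < fhProb p r := lt_of_le_of_ne h3 (fun h => by rw [← h] at hpos; simp at hpos)
    simp only [BinTree.size] at ht
    have a1 := l.height_le_size
    have a2 := r.height_le_size
    have h4 := hbal _ _ _ h1' rfl
    have h5 : δ (max l.height r.height + 1) ≤ δ n := hδ (by omega)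
    exact ⟨by omega, hl (by omega) h2', hr (by omega) h3'⟩

theorem pow_step {x : ℝ} {d i j : ℕ} (hx : 1 ≤ x) (hxd : x ^ (d + 1) = 2) (hij : i ≤ j)
    (hj : j ≤ i + d) : x ^ (1 + j) ≤ x ^ j + x ^ i := by
  obtain ⟨e, rfl⟩ := Nat.exists_eq_add_of_le hij
  have h1 : x ^ (e + 1) ≤ 2 := by
    rw [← hxd]; exact pow_le_pow_right₀ hx (by omega)
  have h2 : 1 ≤ x ^ e := one_le_pow₀ hx
  have h3 : 0 ≤ x ^ i := by positivity
  calc x ^ (1 + (i + e)) = x ^ i * x ^ (e + 1) := by ring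
    _ ≤ x ^ i * (x ^ e + 1) := mul_le_mul_of_nonneg_left (by linarith) h3
    _ = _ := by ring

theorem BinTree.Bal.pow_height {x : ℝ} {d : ℕ} (hx : 1 ≤ x) (hxd : x ^ (d + 1) = 2)
    (t : BinTree) (ht : t.Bal d) : x ^ t.height ≤ t.size + 1 := by
  induction t with
  | leaf => simp [height, size]
  | node l r hl hr =>
    obtain ⟨⟨h1, h2⟩, h3, h4⟩ := ht
    have hl := hl h3
    have hr := hr h4
    simp only [height, size]
    push_cast
    rcases le_total l.height r.height with h | h
    · rw [max_eq_right h]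
      have := pow_step hx hxd h h2
      linarith
    · rw [max_eq_left h]
      have := pow_step hx hxd h h1
      linarith

theorem BinTree.Bal.height_le_log {d b : ℕ} (t : BinTree) (ht : t.Bal d) (hb : t.size < b) :
    t.height ≤ Nat.log 2 (b ^ (d + 1)) := by
  apply Nat.le_log_of_pow_le (by norm_num)
  have hxd : ((2 : ℝ) ^ (((d + 1 : ℕ) : ℝ)⁻¹)) ^ (d + 1) = 2 :=
    Real.rpow_inv_natCast_pow (by norm_num) (by omega)
  set x : ℝ := (2 : ℝ) ^ (((d + 1 : ℕ) : ℝ)⁻¹) with hxdef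
  have hx : 1 ≤ x := Real.one_le_rpow (by norm_num) (by positivity)
  have h := ht.pow_height hx hxd
  have hb' : (t.size : ℝ) + 1 ≤ b := by exact_mod_cast hb
  have h2 : (x ^ t.height) ^ (d + 1) ≤ (b : ℝ) ^ (d + 1) :=
    pow_le_pow_left₀ (by positivity) (h.trans hb') _
  rw [← pow_mul, mul_comm, pow_mul, hxd] at h2
  exact_mod_cast h2

theorem BinTree.countGE_eq_zero {b : ℕ} (t : BinTree) (hb : t.size < b) : t.countGE b = 0 := by
  induction t with
  | leaf => rfl
  | node l r hl hr =>
    have hb2 := hb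
    simp only [size] at hb2
    simp only [countGE]
    rw [if_neg (by omega), hl (by omega), hr (by omega)]

theorem BinTree.Bal.main {d b H : ℕ} (hb : 1 ≤ b)
    (hH : ∀ t : BinTree, t.Bal d → t.size < b → t.height ≤ H)
    (t : BinTree) (ht : t.Bal d) (hs : b ≤ t.size) :
    ∃ L, 1 ≤ L ∧ L * b ≤ t.size ∧
      t.countGE b + 1 ≤ (2 + min t.height (H + d + 1)) * L := by
  induction t with
  | leaf => simp [size] at hs; omega
  | node l r hl hr =>
    obtain ⟨⟨h1, h2⟩, h3, h4⟩ := ht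
    have hc : (node l r).countGE b = 1 + l.countGE b + r.countGE b := by
      simp only [countGE]; rw [if_pos hs]
    have hh : (node l r).height = 1 + max l.height r.height := rfl
    have hsz : (node l r).size = 1 + l.size + r.size := rfl
    rw [hc, hh]
    by_cases hbl : b ≤ l.size <;> by_cases hbr : b ≤ r.size
    · obtain ⟨L, a1, a2, a3⟩ := hl h3 hbl
      obtain ⟨R, b1, b2, b3⟩ := hr h4 hbr
      refine ⟨L + R, by omega, by rw [add_mul]; omega, ?_⟩
      have e1 : (2 + min l.height (H + d + 1)) * L
          ≤ (2 + min (1 + max l.height r.height) (H + d + 1)) * L :=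
        Nat.mul_le_mul_right _ (by omega)
      have e2 : (2 + min r.height (H + d + 1)) * R
          ≤ (2 + min (1 + max l.height r.height) (H + d + 1)) * R :=
        Nat.mul_le_mul_right _ (by omega)
      rw [mul_add]
      omega
    · obtain ⟨L, a1, a2, a3⟩ := hl h3 hbl
      have hz := r.countGE_eq_zero (b := b) (by omega)
      have hK := hH r h4 (by omega)
      refine ⟨L, a1, by omega, ?_⟩
      have e1 : (2 + min l.height (H + d + 1) + 1) * L
          ≤ (2 + min (1 + max l.height r.height) (H + d + 1)) * L :=
        Nat.mul_le_mul_right _ (by omega)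
      rw [add_mul _ 1] at e1
      omega
    · obtain ⟨L, a1, a2, a3⟩ := hr h4 hbr
      have hz := l.countGE_eq_zero (b := b) (by omega)
      have hK := hH l h3 (by omega)
      refine ⟨L, a1, by omega, ?_⟩
      have e1 : (2 + min r.height (H + d + 1) + 1) * L
          ≤ (2 + min (1 + max l.height r.height) (H + d + 1)) * L :=
        Nat.mul_le_mul_right _ (by omega)
      rw [add_mul _ 1] at e1
      omega
    · have hz := l.countGE_eq_zero (b := b) (by omega)
      have hz' := r.countGE_eq_zero (b := b) (by omega)
      exact ⟨1, le_rfl, by omega, by omega⟩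

/-- δ-height-balanced fixed-height sources are fringe dominated:
every tree of positive probability satisfies
`n_{≥b}(t) ≤ 4 ln 2 (2+δ(n)) n (lg b + 2)/b + 2n/b`. -/
theorem statement1 (δ : ℕ → ℕ) (hδ : Monotone δ)
    (p : ℕ → ℕ → ℝ) (hp : IsFixedHeightSource p)
    (hbal : ∀ k i j : ℕ, 0 < p i j → max i j + 1 = k → max i j - min i j ≤ δ k)
    (n : ℕ) (hn : 1 ≤ n) (b : ℕ) (hb : 1 ≤ b)
    (t : BinTree) (ht : t.size = n) (hpos : 0 < fhProb p t) :
    (t.countGE b : ℝ) ≤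
      4 * Real.log 2 * (2 + (δ n : ℝ)) * (n : ℝ) * (Real.logb 2 (b : ℝ) + 2) / (b : ℝ)
        + 2 * (n : ℝ) / (b : ℝ) := by
  have hB := bal_of_pos hδ (fun i j => (hp.1 i j).1) hbal n t ht.le hpos
  have hb0 : (0 : ℝ) < b := by exact_mod_cast hb
  have hL0 : 0 ≤ Real.logb 2 (b : ℝ) := Real.logb_nonneg (by norm_num) (by exact_mod_cast hb)
  have hlog := Real.log_two_gt_d9
  have hd0 : (0 : ℝ) ≤ δ n := by positivity
  have hn0 : (0 : ℝ) ≤ n := by positivity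
  by_cases hs : b ≤ t.size
  · obtain ⟨L, -, h2, h3⟩ := hB.main hb (fun t ht h => ht.height_le_log t h) t hs
    rw [ht] at h2
    set H := Nat.log 2 (b ^ (δ n + 1)) with hHdef
    have hH : (H : ℝ) ≤ (δ n + 1) * Real.logb 2 b := by
      have := Real.natLog_le_logb (b ^ (δ n + 1)) 2
      push_cast [Real.logb_pow] at this
      exact this
    have h4 : t.countGE b ≤ (2 + (H + δ n + 1)) * L := by
      have : (2 + min t.height (H + δ n + 1)) * L ≤ (2 + (H + δ n + 1)) * L :=
        Nat.mul_le_mul_right _ (by omega)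
      omega
    have h4' : (t.countGE b : ℝ) ≤ (2 + (H + δ n + 1)) * L := by exact_mod_cast h4
    have h2' : (L : ℝ) * b ≤ n := by exact_mod_cast h2
    have h5 : (L : ℝ) ≤ n / b := by rwa [le_div_iff₀ hb0]
    have hnb : (0 : ℝ) ≤ n / b := by positivity
    set ℓ := Real.logb 2 (b : ℝ)
    have h6 : (H : ℝ) + δ n + 1 ≤ 4 * Real.log 2 * ((2 + δ n) * (ℓ + 2)) := by
      have h7 : (H : ℝ) + δ n + 1 ≤ (2 + δ n) * (ℓ + 2) := by nlinarith
      have h8 : 0 ≤ (2 + (δ n : ℝ)) * (ℓ + 2) := by positivity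
      nlinarith
    calc (t.countGE b : ℝ) ≤ (2 + (H + δ n + 1)) * L := h4'
      _ ≤ (2 + (H + δ n + 1)) * (n / b) := mul_le_mul_of_nonneg_left h5 (by positivity)
      _ ≤ (2 + 4 * Real.log 2 * ((2 + δ n) * (ℓ + 2))) * (n / b) :=
        mul_le_mul_of_nonneg_right (by linarith) hnb
      _ = _ := by ring
  · rw [t.countGE_eq_zero (by omega)]
    push_cast
    positivity
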